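/- Let d ≥ 1 be an integer and let Ω ⊂ ℝ^d be a bounded open set. Define γ(Ω) as the infimum, over all functions u that are C¹ on a neighbourhood of closure(Ω) and satisfy ∫_{∂Ω} u² dH^{d−1} > 0, of the ratio (∫_Ω (|∇u|² + u²) dx) / (∫_{∂Ω} u² dH^{d−1}), where ∂Ω is the topological boundary of Ω. Then for every ε ∈ (0,1], γ(ε·Ω) ≥ ε·γ(Ω), where ε·Ω := {ε·x : x ∈ Ω}. -/

import Mathlib

open MeasureTheory

/-- The trace quotient constant `γ(Ω)`: the infimum over all `u` that are `C¹` on a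
neighbourhood of `closure Ω` with positive boundary integral of the quotient
`∫_Ω (|∇u|² + u²) / ∫_{∂Ω} u²`. -/
noncomputable def gam (d : ℕ) (Ω : Set (EuclideanSpace ℝ (Fin d))) : ℝ :=
  sInf { q : ℝ | ∃ u : EuclideanSpace ℝ (Fin d) → ℝ,
    (∃ V : Set (EuclideanSpace ℝ (Fin d)), IsOpen V ∧ closure Ω ⊆ V ∧ ContDiffOn ℝ 1 u V) ∧
    (0 < ∫ x in frontier Ω, (u x)^2 ∂(μH[(d:ℝ) - 1])) ∧
    q = (∫ x in Ω, (‖gradient u x‖^2 + (u x)^2)) /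
        ∫ x in frontier Ω, (u x)^2 ∂(μH[(d:ℝ) - 1]) }

open scoped Pointwise

/-- Dilation by `a ≠ 0` scales `s`-dimensional Hausdorff integrals by `|a| ^ s`. -/
theorem setIntegral_hausdorffMeasure_smul {E : Type*} [NormedAddCommGroup E] [NormedSpace ℝ E]
    [MeasurableSpace E] [BorelSpace E] {s : ℝ} (hs : 0 ≤ s) {a : ℝ} (ha : a ≠ 0)
    (A : Set E) (f : E → ℝ) :
    ∫ x in a • A, f x ∂(μH[s]) = |a| ^ s * ∫ x in A, f (a • x) ∂(μH[s]) := by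
  have hemb : MeasurableEmbedding (fun x : E => a • x) :=
    (Homeomorph.smulOfNeZero a ha).measurableEmbedding
  have hmap : (μH[s] : Measure E) =
      (‖a‖₊ ^ s) • Measure.map (fun x : E => a • x) (μH[s] : Measure E) := by
    ext t _
    rw [Measure.smul_apply, hemb.map_apply, ← Measure.hausdorffMeasure_smul₀ hs ha]
    congr 1
    exact (Set.image_preimage_eq t (Homeomorph.smulOfNeZero a ha).surjective).symm
  have hpre : (fun x : E => a • x) ⁻¹' (a • A) = A :=
    Set.preimage_image_eq A hemb.injective
  conv_lhs => rw [hmap]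
  rw [Measure.restrict_smul, integral_smul_nnreal_measure, hemb.setIntegral_map, hpre,
    NNReal.smul_def, NNReal.coe_rpow, coe_nnnorm, Real.norm_eq_abs, smul_eq_mul]

/-- The gradient of a dilated function. -/
theorem gradient_comp_smul {F : Type*} [NormedAddCommGroup F] [InnerProductSpace ℝ F]
    [CompleteSpace F] (u : F → ℝ) (a : ℝ) (x : F) :
    gradient (fun y => u (a • y)) x = a • gradient u (a • x) := by
  simp [gradient, fderiv_comp_smul]

/-- A function that is `C¹` on a neighbourhood of `closure (a • Ω)` becomes `C¹` on a
neighbourhood of `closure Ω` after precomposition with the dilation by `a`. -/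
theorem exists_contDiffOn_comp_smul {F : Type*} [NormedAddCommGroup F] [NormedSpace ℝ F]
    {Ω : Set F} {u : F → ℝ} {a : ℝ} (ha : a ≠ 0)
    (h : ∃ V : Set F, IsOpen V ∧ closure (a • Ω) ⊆ V ∧ ContDiffOn ℝ 1 u V) :
    ∃ V : Set F, IsOpen V ∧ closure Ω ⊆ V ∧ ContDiffOn ℝ 1 (fun x => u (a • x)) V := by
  obtain ⟨V, hV, hsub, hu⟩ := h
  refine ⟨(fun x => a • x) ⁻¹' V, hV.preimage (continuous_const_smul a), fun x hx => ?_,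
    hu.comp (contDiff_const_smul a).contDiffOn fun x hx => hx⟩
  apply hsub
  rw [closure_smul₀' ha]
  exact Set.smul_mem_smul_set hx

/-- Dilations commute with the topological frontier. -/
theorem frontier_smul_of_ne_zero {F : Type*} [NormedAddCommGroup F] [NormedSpace ℝ F]
    {a : ℝ} (ha : a ≠ 0) (Ω : Set F) : frontier (a • Ω) = a • frontier Ω :=
  ((Homeomorph.smulOfNeZero a ha).image_frontier Ω).symm

/-- A `C¹` function near the closure of a bounded set has an integrable square and an integrable
squared gradient on that set. -/
theorem integrableOn_sq_and_gradient_sq {d : ℕ} {Ω : Set (EuclideanSpace ℝ (Fin d))}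
    {u : EuclideanSpace ℝ (Fin d) → ℝ} (hΩb : Bornology.IsBounded Ω)
    (h : ∃ V : Set (EuclideanSpace ℝ (Fin d)),
      IsOpen V ∧ closure Ω ⊆ V ∧ ContDiffOn ℝ 1 u V) :
    IntegrableOn (fun x => ‖gradient u x‖ ^ 2) Ω ∧ IntegrableOn (fun x => (u x) ^ 2) Ω := by
  obtain ⟨V, hV, hsub, hu⟩ := h
  have hK : IsCompact (closure Ω) := hΩb.isCompact_closure
  have hg : ContinuousOn (gradient u) V :=
    (InnerProductSpace.toDual ℝ _).symm.continuous.comp_continuousOn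
      (hu.continuousOn_fderiv_of_isOpen hV le_rfl)
  exact ⟨(((hg.mono hsub).norm.pow 2).integrableOn_compact hK).mono_set subset_closure,
    (((hu.continuousOn.mono hsub).pow 2).integrableOn_compact hK).mono_set subset_closure⟩

theorem stmt6 (d : ℕ) (hd : 1 ≤ d) (Ω : Set (EuclideanSpace ℝ (Fin d)))
    (hΩo : IsOpen Ω) (hΩb : Bornology.IsBounded Ω) :
    ∀ ε : ℝ, ε ∈ Set.Ioc (0:ℝ) 1 →
      ε * gam d Ω ≤ gam d ((fun x => ε • x) '' Ω) := by
  rintro ε ⟨hε, hε1⟩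
  have hs : (0 : ℝ) ≤ (d : ℝ) - 1 := by
    have : (1 : ℝ) ≤ d := by exact_mod_cast hd
    linarith
  have hbdry : ∀ (a : ℝ), 0 < a → ∀ (A : Set (EuclideanSpace ℝ (Fin d)))
      (u : EuclideanSpace ℝ (Fin d) → ℝ),
      ∫ x in frontier (a • A), (u x) ^ 2 ∂(μH[(d:ℝ) - 1]) =
        a ^ ((d:ℝ) - 1) * ∫ x in frontier A, (u (a • x)) ^ 2 ∂(μH[(d:ℝ) - 1]) := by
    intro a ha A u
    rw [frontier_smul_of_ne_zero ha.ne', setIntegral_hausdorffMeasure_smul hs ha.ne',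
      abs_of_pos ha]
  change ε * gam d Ω ≤ gam d (ε • Ω)
  unfold gam
  rcases Set.eq_empty_or_nonempty { q : ℝ | ∃ u : EuclideanSpace ℝ (Fin d) → ℝ,
    (∃ V : Set (EuclideanSpace ℝ (Fin d)),
      IsOpen V ∧ closure (ε • Ω) ⊆ V ∧ ContDiffOn ℝ 1 u V) ∧
    (0 < ∫ x in frontier (ε • Ω), (u x)^2 ∂(μH[(d:ℝ) - 1])) ∧
    q = (∫ x in ε • Ω, (‖gradient u x‖^2 + (u x)^2)) /
        ∫ x in frontier (ε • Ω), (u x)^2 ∂(μH[(d:ℝ) - 1]) } with hT | hT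
  · rw [hT, Real.sInf_empty]
    refine (mul_eq_zero_of_right ε ?_).le
    convert Real.sInf_empty
    rw [Set.eq_empty_iff_forall_notMem]
    rintro q ⟨u, hu, hpos, -⟩
    have hΩ : Ω = ε⁻¹ • (ε • Ω) := (inv_smul_smul₀ hε.ne' Ω).symm
    rw [hΩ] at hu hpos
    rw [hbdry _ (inv_pos.2 hε)] at hpos
    exact Set.eq_empty_iff_forall_notMem.1 hT _ ⟨fun x => u (ε⁻¹ • x),
      exists_contDiffOn_comp_smul (inv_ne_zero hε.ne') hu,
      pos_of_mul_pos_right hpos (Real.rpow_nonneg (inv_pos.2 hε).le _), rfl⟩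
  · refine le_csInf hT ?_
    rintro q ⟨u, hu, hpos, rfl⟩
    have hint := integrableOn_sq_and_gradient_sq (hΩb.smul₀ ε) hu
    have hB := hbdry ε hε Ω u
    have hpos' : 0 < ∫ x in frontier Ω, (u (ε • x)) ^ 2 ∂(μH[(d:ℝ) - 1]) :=
      pos_of_mul_pos_right (hB ▸ hpos) (Real.rpow_nonneg hε.le _)
    have hnum : ∫ x in Ω, (‖gradient (fun y => u (ε • y)) x‖ ^ 2 + (u (ε • x)) ^ 2) ≤
        (ε ^ d)⁻¹ * ∫ x in ε • Ω, (‖gradient u x‖ ^ 2 + (u x) ^ 2) := by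
      have hcv := Measure.setIntegral_comp_smul_of_pos (volume : Measure (EuclideanSpace ℝ (Fin d)))
        (fun x => ε ^ 2 * ‖gradient u x‖ ^ 2 + (u x) ^ 2) Ω hε
      rw [finrank_euclideanSpace_fin, smul_eq_mul] at hcv
      simp only [gradient_comp_smul, norm_smul, mul_pow, Real.norm_eq_abs, sq_abs]
      rw [hcv]
      refine mul_le_mul_of_nonneg_left ?_ (by positivity)
      refine integral_mono ((hint.1.const_mul _).add hint.2) (hint.1.add hint.2) fun x => ?_
      have : ε ^ 2 ≤ 1 := pow_le_one₀ hε.le hε1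
      have := mul_le_mul_of_nonneg_right this (sq_nonneg ‖gradient u x‖)
      beta_reduce
      linarith
    have hle := csInf_le (a := (∫ x in Ω, (‖gradient (fun y => u (ε • y)) x‖ ^ 2 +
        (u (ε • x)) ^ 2)) / ∫ x in frontier Ω, (u (ε • x)) ^ 2 ∂(μH[(d:ℝ) - 1]))
      (s := { q : ℝ | ∃ u : EuclideanSpace ℝ (Fin d) → ℝ,
        (∃ V : Set (EuclideanSpace ℝ (Fin d)), IsOpen V ∧ closure Ω ⊆ V ∧ ContDiffOn ℝ 1 u V) ∧
        (0 < ∫ x in frontier Ω, (u x)^2 ∂(μH[(d:ℝ) - 1])) ∧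
        q = (∫ x in Ω, (‖gradient u x‖^2 + (u x)^2)) /
            ∫ x in frontier Ω, (u x)^2 ∂(μH[(d:ℝ) - 1]) })
      ⟨0, by
        rintro q ⟨w, -, hw, rfl⟩
        exact div_nonneg (integral_nonneg fun x => by positivity) hw.le⟩
      ⟨fun x => u (ε • x), exists_contDiffOn_comp_smul hε.ne' hu, hpos', rfl⟩
    refine (mul_le_mul_of_nonneg_left hle hε.le).trans ?_
    rw [hB, mul_div_assoc', div_le_div_iff₀ hpos' (by positivity)]
    have hpow : ε * ε ^ ((d:ℝ) - 1) = ε ^ d := by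
      rw [Real.rpow_sub_one hε.ne', Real.rpow_natCast]
      field_simp
    have hnum' := mul_le_mul_of_nonneg_left hnum (pow_pos hε d).le
    rw [mul_inv_cancel_left₀ (pow_pos hε d).ne', ← hpow] at hnum'
    have := mul_le_mul_of_nonneg_right hnum' hpos'.le
    linarith
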